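/- Let f be a multiplicative arithmetic function belonging to the universality class ℬ{N^{a1}(log N)^{b1}; N^{−a2}(log N)^{−b2}} with admissible parameters, let p_1, ..., p_n be n distinct primes and m_1, ..., m_n ≥ 0 integers, and suppose there exist real numbers K > 0 and γ < a1 and an integer r* ≥ 0 such that |L_r(f;p_i^{m_i})| ≤ K·p_i^{γr} for every 1 ≤ i ≤ n and all r ≥ r*. Then the renormalization function is multiplicative over distinct prime powers: each limit R_∞(f;p_i^{m_i}) = lim_{N→∞} F(f;N,p_i^{m_i})/F(f;N,1) exists, the limit R_∞(f;∏_{i=1}^{n} p_i^{m_i}) = lim_{N→∞} [∑_{k=1}^{N} f(k·∏_{i=1}^{n} p_i^{m_i})]/[∑_{k=1}^{N} f(k)] exists, and R_∞(f;∏_{i=1}^{n} p_i^{m_i}) = ∏_{i=1}^{n} R_∞(f;p_i^{m_i}). -/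

import Mathlib

open Filter

/-- `f` is a multiplicative arithmetic function on the positive integers. -/
def IsMultiplicativeFn (f : ℕ → ℝ) : Prop :=
  f 1 = 1 ∧ ∀ a b : ℕ, 0 < a → 0 < b → Nat.gcd a b = 1 → f (a * b) = f a * f b

/-- Characteristic functions `L_r(f; p^m)`. -/
noncomputable def charL (f : ℕ → ℝ) (p m : ℕ) : ℕ → ℝ
  | 0 => f (p ^ m)
  | r + 1 =>
      f (p ^ (m + (r + 1))) -
        ∑ j : Fin (r + 1), charL f p m j * f (p ^ (r + 1 - (j : ℕ)))
  decreasing_by exact j.isLt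

/-- Admissible parameters. -/
def AdmissibleParams (a1 b1 a2 b2 : ℝ) : Prop :=
  (0 < a1 ∨ (a1 = 0 ∧ 0 ≤ b1)) ∧ (0 < a2 ∨ (a2 = 0 ∧ 0 < b2))

/-- `f` belongs to the universality class `ℬ{N^{a1}(log N)^{b1}; N^{-a2}(log N)^{-b2}}`. -/
def InUniversalityClass (f : ℕ → ℝ) (a1 b1 a2 b2 : ℝ) : Prop :=
  ∃ Fc C : ℝ, 0 < Fc ∧ 0 < C ∧
    Tendsto (fun N : ℕ =>
        (∑ k ∈ Finset.Icc 1 N, f k) / (Fc * (N : ℝ) ^ a1 * Real.log N ^ b1))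
      atTop (nhds 1) ∧
    ∀ᶠ N : ℕ in atTop,
      |(∑ k ∈ Finset.Icc 1 N, f k) / (Fc * (N : ℝ) ^ a1 * Real.log N ^ b1) - 1|
        < C * (N : ℝ) ^ (-a2) * Real.log N ^ (-b2)

/-- The comparison function. -/
noncomputable def hcmp (a b x : ℝ) : ℝ := x ^ a * Real.log x ^ b

lemma hcmp_pos (a b x : ℝ) (hx : 1 < x) : 0 < hcmp a b x := by
  unfold hcmp
  have := Real.log_pos hx
  positivity

lemma charL_conv (f : ℕ → ℝ) (h1 : f 1 = 1) (p m s : ℕ) :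
    f (p ^ (m + s)) = ∑ j ∈ Finset.range (s + 1), charL f p m j * f (p ^ (s - j)) := by
  rw [Finset.sum_range_succ]
  simp only [Nat.sub_self, pow_zero, h1, mul_one]
  cases s with
  | zero => simp [charL]
  | succ r =>
    conv_rhs => rw [charL]
    rw [Finset.sum_range]
    ring

lemma pointwise_conv (f : ℕ → ℝ) (hf : IsMultiplicativeFn f) (p m P N k : ℕ)
    (hp : p.Prime) (hP : 0 < P) (hpP : Nat.Coprime p P) (hk : 0 < k) (hkN : k ≤ N) :
    f (k * (p ^ m * P)) =
      ∑ r ∈ Finset.range (N + 1), if p ^ r ∣ k then charL f p m r * f (k / p ^ r * P) else 0 := by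
  obtain ⟨s, k', hk', rfl⟩ := Nat.exists_eq_pow_mul_and_not_dvd hk.ne' p hp.ne_one
  have hk'0 : 0 < k' := Nat.pos_of_ne_zero (by rintro rfl; simp at hk)
  have hcop : Nat.Coprime p (k' * P) :=
    Nat.Coprime.mul_right ((Nat.Prime.coprime_iff_not_dvd hp).2 hk') hpP
  have hsN : s ≤ N := by
    have h1 : s < p ^ s := Nat.lt_pow_self hp.one_lt
    have h2 : p ^ s ≤ p ^ s * k' := Nat.le_mul_of_pos_right _ hk'0
    omega
  have hdvd : ∀ r, p ^ r ∣ p ^ s * k' ↔ r ≤ s := by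
    intro r
    constructor
    · intro h
      have hc : Nat.Coprime (p ^ r) k' :=
        Nat.Coprime.pow_left _ ((Nat.Prime.coprime_iff_not_dvd hp).2 hk')
      exact (Nat.pow_dvd_pow_iff_le_right hp.one_lt).1 (hc.dvd_of_dvd_mul_right h)
    · intro h
      exact Dvd.dvd.mul_right (pow_dvd_pow _ h) _
  have hmul : ∀ t, f (p ^ t * (k' * P)) = f (p ^ t) * f (k' * P) := fun t =>
    hf.2 _ _ (pow_pos hp.pos _) (Nat.mul_pos hk'0 hP) (Nat.Coprime.pow_left _ hcop)
  have e : p ^ s * k' * (p ^ m * P) = p ^ (m + s) * (k' * P) := by ring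
  rw [e, hmul, charL_conv f hf.1, Finset.sum_mul]
  rw [← Finset.sum_subset (Finset.range_mono (by omega : s + 1 ≤ N + 1))]
  · apply Finset.sum_congr rfl
    intro r hr
    have hrs : r ≤ s := by simpa [Nat.lt_succ_iff] using hr
    rw [if_pos ((hdvd r).2 hrs)]
    have e2 : p ^ s * k' / p ^ r = p ^ (s - r) * k' := by
      rw [Nat.mul_div_right_comm (pow_dvd_pow _ hrs), Nat.pow_div hrs hp.pos]
    rw [e2, mul_assoc (p ^ (s - r)), hmul]
    ring
  · intro r _ hr
    rw [if_neg]
    rw [hdvd]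
    simpa using hr

lemma sum_dvd (g : ℕ → ℝ) (d N : ℕ) (hd : 0 < d) :
    (∑ k ∈ Finset.Icc 1 N, if d ∣ k then g (k / d) else 0) =
      ∑ j ∈ Finset.Icc 1 (N / d), g j := by
  rw [← Finset.sum_filter]
  symm
  apply Finset.sum_bij (fun j _ => d * j)
  · intro j hj
    simp only [Finset.mem_Icc, Finset.mem_filter] at *
    refine ⟨⟨Nat.mul_pos hd hj.1, ?_⟩, dvd_mul_right _ _⟩
    have := (Nat.le_div_iff_mul_le hd).1 hj.2
    rwa [mul_comm]
  · intro i _ j _ h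
    exact Nat.eq_of_mul_eq_mul_left hd h
  · intro k hk
    simp only [Finset.mem_Icc, Finset.mem_filter] at hk
    obtain ⟨⟨h1, h2⟩, j, rfl⟩ := hk
    refine ⟨j, ?_, rfl⟩
    simp only [Finset.mem_Icc]
    refine ⟨Nat.pos_of_mul_pos_left h1, ?_⟩
    rw [Nat.le_div_iff_mul_le hd, mul_comm]
    exact h2
  · intro j _
    rw [Nat.mul_div_cancel_left _ hd]

lemma sum_conv (f : ℕ → ℝ) (hf : IsMultiplicativeFn f) (p m P N : ℕ)
    (hp : p.Prime) (hP : 0 < P) (hpP : Nat.Coprime p P) :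
    (∑ k ∈ Finset.Icc 1 N, f (k * (p ^ m * P))) =
      ∑' r, charL f p m r * ∑ k ∈ Finset.Icc 1 (N / p ^ r), f (k * P) := by
  rw [tsum_eq_sum (s := Finset.range (N + 1))]
  · calc _ = ∑ k ∈ Finset.Icc 1 N, ∑ r ∈ Finset.range (N + 1),
            if p ^ r ∣ k then charL f p m r * f (k / p ^ r * P) else 0 := by
          apply Finset.sum_congr rfl
          intro k hk
          rw [Finset.mem_Icc] at hk
          exact pointwise_conv f hf p m P N k hp hP hpP hk.1 hk.2
      _ = _ := by
          rw [Finset.sum_comm]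
          apply Finset.sum_congr rfl
          intro r _
          rw [sum_dvd (fun k => charL f p m r * f (k * P)) _ _ (pow_pos hp.pos _),
            Finset.mul_sum]
  · intro r hr
    have h1 : r < p ^ r := Nat.lt_pow_self hp.one_lt
    have h2 : N < r := by simpa using hr
    rw [Nat.div_eq_of_lt (by omega)]
    simp

/-- almost monotonicity of `x^ε (log x)^b` -/
lemma q_mono (ε b : ℝ) (h : 0 < ε ∨ (ε = 0 ∧ 0 ≤ b)) :
    ∃ X : ℝ, 1 < X ∧ ∀ x y, X ≤ x → x ≤ y → hcmp ε b x ≤ hcmp ε b y := by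
  have hε : 0 ≤ ε := by rcases h with h | h <;> linarith
  by_cases hb : 0 ≤ b
  · refine ⟨2, by norm_num, fun x y hx hxy => ?_⟩
    unfold hcmp
    have h1 : 0 < Real.log x := Real.log_pos (by linarith)
    have h2 : Real.log x ≤ Real.log y := Real.log_le_log (by linarith) hxy
    have h3 : x ^ ε ≤ y ^ ε := Real.rpow_le_rpow (by linarith) hxy hε
    have h4 : Real.log x ^ b ≤ Real.log y ^ b := Real.rpow_le_rpow h1.le h2 hb
    have : 0 ≤ y ^ ε := Real.rpow_nonneg (by linarith) _
    exact mul_le_mul h3 h4 (by positivity) this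
  · push Not at hb
    have hε : 0 < ε := by
      rcases h with h | h
      · exact h
      · linarith [h.2]
    have hc : 0 < ε / (-b) := div_pos hε (by linarith)
    refine ⟨Real.exp ((ε / (-b))⁻¹), ?_, fun x y hx hxy => ?_⟩
    · rw [← Real.exp_zero]
      exact Real.exp_lt_exp.2 (by positivity)
    · have hX : (1:ℝ) < Real.exp ((ε / (-b))⁻¹) := by
        rw [← Real.exp_zero]
        exact Real.exp_lt_exp.2 (by positivity)
      have key := Real.log_div_self_rpow_antitoneOn hc (show x ∈ {x | _ ≤ x} from hx)
        (show y ∈ {x | _ ≤ x} from hx.trans hxy) hxy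
      have hq : ∀ z : ℝ, 1 < z → hcmp ε b z = (Real.log z / z ^ (ε / (-b))) ^ b := by
        intro z hz
        have hl := Real.log_pos hz
        have hz0 : 0 < z := by linarith
        unfold hcmp
        rw [Real.div_rpow hl.le (by positivity), ← Real.rpow_mul hz0.le]
        have : ε / (-b) * b = -ε := by
          have : b ≠ 0 := hb.ne
          field_simp
        rw [this, Real.rpow_neg hz0.le]
        field_simp
      rw [hq x (by linarith), hq y (by linarith)]
      have hl := Real.log_pos (show 1 < y by linarith)
      have hy0 : 0 < y := by linarith
      exact Real.rpow_le_rpow_of_nonpos (by positivity) key hb.le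

lemma domination (T : ℕ → ℝ) (a b g A : ℝ) (hg : 0 ≤ g) (h : g < a ∨ (a = g ∧ 0 ≤ b))
    (hT0 : T 0 = 0)
    (hT : Tendsto (fun N : ℕ => T N / hcmp a b N) atTop (nhds A)) :
    ∃ C : ℝ, 0 ≤ C ∧ ∃ N0 : ℕ, 1 < N0 ∧ ∀ N d : ℕ, N0 ≤ N → 0 < d →
      |T (N / d)| ≤ C * (d : ℝ) ^ (-g) * hcmp a b N := by
  obtain ⟨X, hX1, hX⟩ := q_mono (a - g) b (by
    rcases h with h | h
    · left; linarith
    · right; exact ⟨by linarith, h.2⟩)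
  have hev : ∀ᶠ N : ℕ in atTop, |T N / hcmp a b N| < |A| + 1 :=
    hT.abs.eventually (gt_mem_nhds (by linarith))
  obtain ⟨N1, hN1⟩ := eventually_atTop.1 hev
  set N0 := max N1 (max 2 ⌈X⌉₊) with hN0
  have hN0X : ∀ N, N0 ≤ N → X ≤ (N : ℝ) := by
    intro N hN
    have : ⌈X⌉₊ ≤ N := by omega
    exact Nat.ceil_le.1 this
  have hc : 0 < hcmp (a - g) b N0 := hcmp_pos _ _ _ (by linarith [hN0X N0 le_rfl])
  have hqh : ∀ N : ℕ, N0 ≤ N → hcmp a b N = (N : ℝ) ^ g * hcmp (a - g) b N := by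
    intro N hN
    have : (0 : ℝ) < N := by linarith [hN0X N hN]
    unfold hcmp
    rw [← mul_assoc, ← Real.rpow_add this]
    congr 2
    ring
  set S := ∑ k ∈ Finset.range N0, |T k| with hS
  have hSn : 0 ≤ S := Finset.sum_nonneg fun _ _ => abs_nonneg _
  set C := (|A| + 1) + S / hcmp (a - g) b N0 with hC
  have hCn : 0 ≤ C := by positivity
  -- claim
  have claim : ∀ M N : ℕ, N0 ≤ N → 1 ≤ M → M ≤ N →
      |T M| ≤ C * (M : ℝ) ^ g * hcmp (a - g) b N := by
    intro M N hN hM hMN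
    have hqN : hcmp (a - g) b N0 ≤ hcmp (a - g) b N :=
      hX _ _ (hN0X N0 le_rfl) (by exact_mod_cast hN)
    have hM1 : (1 : ℝ) ≤ (M : ℝ) ^ g := Real.one_le_rpow (by exact_mod_cast hM) hg
    by_cases hMN0 : N0 ≤ M
    · have hMN' : hcmp (a - g) b M ≤ hcmp (a - g) b N := hX _ _ (hN0X M hMN0) (by exact_mod_cast hMN)
      have hpos : 0 < hcmp a b M := hcmp_pos _ _ _ (by linarith [hN0X M hMN0])
      have h1 := hN1 M (by omega)
      rw [abs_div, abs_of_pos hpos, div_lt_iff₀ hpos] at h1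
      rw [hqh M hMN0] at h1
      calc |T M| ≤ (|A| + 1) * ((M : ℝ) ^ g * hcmp (a - g) b M) := h1.le
        _ ≤ C * ((M : ℝ) ^ g * hcmp (a - g) b N) := by
            apply mul_le_mul
            · rw [hC]; linarith [show 0 ≤ S / hcmp (a - g) b N0 by positivity]
            · gcongr
            · have : 0 < hcmp (a - g) b M := hcmp_pos _ _ _ (by linarith [hN0X M hMN0])
              positivity
            · exact hCn
        _ = _ := by ring
    · push Not at hMN0
      have h1 : |T M| ≤ S :=
        Finset.single_le_sum (f := fun k => |T k|) (fun _ _ => abs_nonneg _) (Finset.mem_range.2 hMN0)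
      calc |T M| ≤ S := h1
        _ = S / hcmp (a - g) b N0 * 1 * hcmp (a - g) b N0 := by field_simp
        _ ≤ C * (M : ℝ) ^ g * hcmp (a - g) b N := by
            have : S / hcmp (a - g) b N0 ≤ C := by
              rw [hC]; linarith [abs_nonneg A]
            gcongr
  refine ⟨C, hCn, N0, by omega, fun N d hN hd => ?_⟩
  have hhpos : 0 < hcmp a b N := hcmp_pos _ _ _ (by linarith [hN0X N hN])
  have hqpos : 0 < hcmp (a - g) b N := hcmp_pos _ _ _ (by linarith [hN0X N hN])
  rcases Nat.eq_zero_or_pos (N / d) with h0 | h0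
  · rw [h0, hT0, abs_zero]
    positivity
  · refine (claim _ _ hN h0 (Nat.div_le_self _ _)).trans ?_
    rw [hqh N hN]
    have hd' : (0 : ℝ) < d := by exact_mod_cast hd
    have : ((N / d : ℕ) : ℝ) ^ g ≤ (d : ℝ) ^ (-g) * (N : ℝ) ^ g := by
      calc ((N / d : ℕ) : ℝ) ^ g ≤ ((N : ℝ) / d) ^ g :=
            Real.rpow_le_rpow (by positivity) Nat.cast_div_le hg
        _ = _ := by
            rw [Real.div_rpow (by positivity) hd'.le, Real.rpow_neg hd'.le]
            field_simp
    calc C * ((N / d : ℕ) : ℝ) ^ g * hcmp (a - g) b N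
        ≤ C * ((d : ℝ) ^ (-g) * (N : ℝ) ^ g) * hcmp (a - g) b N := by gcongr
      _ = _ := by ring

lemma div_tendsto_atTop (d : ℕ) (hd : 0 < d) :
    Tendsto (fun N : ℕ => N / d) atTop atTop :=
  Nat.tendsto_div_const_atTop hd.ne'

lemma ratio_tendsto (d : ℕ) (hd : 0 < d) :
    Tendsto (fun N : ℕ => ((N / d : ℕ) : ℝ) / N) atTop (nhds ((d : ℝ)⁻¹)) := by
  have h := (tendsto_nat_floor_mul_div_atTop (R := ℝ) (a := (d : ℝ)⁻¹) (by positivity)).comp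
    (tendsto_natCast_atTop_atTop (R := ℝ))
  refine h.congr fun N => ?_
  simp only [Function.comp]
  rw [inv_mul_eq_div, Nat.floor_div_eq_div]

lemma hcmp_ratio (a b : ℝ) (d : ℕ) (hd : 0 < d) :
    Tendsto (fun N : ℕ => hcmp a b ((N / d : ℕ) : ℝ) / hcmp a b N) atTop
      (nhds ((d : ℝ) ^ (-a))) := by
  have hd' : (0 : ℝ) < d := by exact_mod_cast hd
  have h1 := ratio_tendsto d hd
  have h2 : Tendsto (fun N : ℕ => (((N / d : ℕ) : ℝ) / N) ^ a) atTop (nhds ((d : ℝ) ^ (-a))) := by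
    have := h1.rpow_const (p := a) (Or.inl (by positivity))
    rwa [Real.inv_rpow hd'.le, ← Real.rpow_neg hd'.le] at this
  have hlogN : Tendsto (fun N : ℕ => Real.log (N : ℝ)) atTop atTop :=
    Real.tendsto_log_atTop.comp tendsto_natCast_atTop_atTop
  have h3 : Tendsto (fun N : ℕ => 1 + Real.log (((N / d : ℕ) : ℝ) / N) / Real.log N) atTop
      (nhds (1 + 0)) :=
    tendsto_const_nhds.add ((h1.log (by positivity)).div_atTop hlogN)
  have h4 := (h3.rpow_const (p := b) (Or.inl (by norm_num)))
  have h5 := h2.mul h4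
  simp only [add_zero, Real.one_rpow, mul_one] at h5
  refine h5.congr' ?_
  filter_upwards [eventually_ge_atTop 2, (div_tendsto_atTop d hd).eventually_ge_atTop 2] with N hN hM
  have hN' : (2 : ℝ) ≤ N := by exact_mod_cast hN
  have hM' : (2 : ℝ) ≤ ((N / d : ℕ) : ℝ) := by exact_mod_cast hM
  have l1 := Real.log_pos (show (1 : ℝ) < N by linarith)
  have l2 := Real.log_pos (show (1 : ℝ) < ((N / d : ℕ) : ℝ) by linarith)
  have e : 1 + Real.log (((N / d : ℕ) : ℝ) / N) / Real.log N =
      Real.log ((N / d : ℕ) : ℝ) / Real.log N := by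
    rw [Real.log_div (by linarith) (by linarith)]
    field_simp
    ring
  rw [e, Real.div_rpow (by positivity) (by positivity), Real.div_rpow l2.le l1.le]
  unfold hcmp
  rw [div_mul_div_comm]

lemma main_step (T L : ℕ → ℝ) (a b A K γ : ℝ) (p rstar : ℕ) (hp : p.Prime)
    (hadm : 0 < a ∨ (a = 0 ∧ 0 ≤ b)) (hγ : γ < a)
    (hL : ∀ r : ℕ, rstar ≤ r → |L r| ≤ K * (p : ℝ) ^ (γ * r))
    (hT0 : T 0 = 0)
    (hT : Tendsto (fun N : ℕ => T N / hcmp a b N) atTop (nhds A)) :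
    Tendsto (fun N : ℕ => (∑' r, L r * T (N / p ^ r)) / hcmp a b N) atTop
      (nhds (A * ∑' r : ℕ, L r * ((p ^ r : ℕ) : ℝ) ^ (-a))) := by
  obtain ⟨g, hg0, hγg, hga⟩ : ∃ g : ℝ, 0 ≤ g ∧ γ < g ∧ (g < a ∨ (a = g ∧ 0 ≤ b)) := by
    rcases hadm with h | h
    · refine ⟨(max γ 0 + a) / 2, ?_, ?_, Or.inl ?_⟩
      · have := le_max_right γ 0; linarith
      · have := le_max_left γ 0; linarith
      · have := max_lt hγ h; linarith
    · exact ⟨0, le_rfl, by linarith [h.1], Or.inr h⟩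
  obtain ⟨C, hC, N0, hN0, hdom⟩ := domination T a b g A hg0 hga hT0 hT
  have hp0 : (0 : ℝ) < p := by exact_mod_cast hp.pos
  have hp1 : (1 : ℝ) < p := by exact_mod_cast hp.one_lt
  have hcast : ∀ (r : ℕ) (t : ℝ), ((p ^ r : ℕ) : ℝ) ^ t = (p : ℝ) ^ (t * r) := by
    intro r t
    rw [Nat.cast_pow, ← Real.rpow_natCast, ← Real.rpow_mul hp0.le, mul_comm]
  have hsum : Summable fun r : ℕ => |L r| * (C * ((p ^ r : ℕ) : ℝ) ^ (-g)) := by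
    have hgeo : Summable fun r : ℕ => K * C * ((p : ℝ) ^ (γ - g)) ^ r :=
      (summable_geometric_of_lt_one (by positivity)
        (Real.rpow_lt_one_of_one_lt_of_neg hp1 (by linarith))).mul_left _
    refine Summable.of_norm_bounded_eventually_nat hgeo ?_
    filter_upwards [eventually_ge_atTop rstar] with r hr
    have hn : 0 ≤ C * ((p ^ r : ℕ) : ℝ) ^ (-g) := by positivity
    rw [Real.norm_of_nonneg (by positivity)]
    refine (mul_le_mul_of_nonneg_right (hL r hr) hn).trans (le_of_eq ?_)
    rw [hcast, ← Real.rpow_natCast, ← Real.rpow_mul hp0.le, sub_mul, sub_eq_add_neg,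
      Real.rpow_add hp0, neg_mul]
    ring
  have key := tendsto_tsum_of_dominated_convergence (𝓕 := atTop)
    (f := fun (N : ℕ) (r : ℕ) => L r * T (N / p ^ r) / hcmp a b N)
    (g := fun r : ℕ => A * (L r * ((p ^ r : ℕ) : ℝ) ^ (-a))) hsum ?_ ?_
  · rw [← tsum_mul_left]
    refine key.congr fun N => ?_
    rw [tsum_div_const]
  · intro r
    have hd : 0 < p ^ r := pow_pos hp.pos r
    have h1 := hT.comp (div_tendsto_atTop _ hd)
    have h2 := ((h1.mul (hcmp_ratio a b _ hd)).const_mul (L r))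
    rw [show A * (L r * ((p ^ r : ℕ) : ℝ) ^ (-a)) = L r * (A * ((p ^ r : ℕ) : ℝ) ^ (-a)) by ring]
    refine h2.congr' ?_
    filter_upwards [(div_tendsto_atTop _ hd).eventually_ge_atTop 2] with N hM
    have hM' : (2 : ℝ) ≤ ((N / p ^ r : ℕ) : ℝ) := by exact_mod_cast hM
    have := hcmp_pos a b _ (show (1 : ℝ) < ((N / p ^ r : ℕ) : ℝ) by linarith)
    simp only [Function.comp]
    rw [div_mul_div_cancel₀ this.ne', mul_div_assoc]
  · filter_upwards [eventually_ge_atTop N0] with N hN r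
    have hpos : 0 < hcmp a b N := hcmp_pos _ _ _ (by exact_mod_cast (by omega : 1 < N))
    rw [Real.norm_eq_abs, abs_div, abs_mul, abs_of_pos hpos, div_le_iff₀ hpos, mul_assoc]
    exact mul_le_mul_of_nonneg_left (hdom N (p ^ r) hN (pow_pos hp.pos r)) (abs_nonneg _)

/-- Corollary 1 of the paper: multiplicativity of the renormalization
function over distinct prime powers:
`R_∞(f; ∏ p_i^{m_i}) = ∏ R_∞(f; p_i^{m_i})`, all the limits existing. -/
theorem renormalization_multiplicative
    (f : ℕ → ℝ) (a1 b1 a2 b2 : ℝ) (n : ℕ) (p : Fin n → ℕ) (m : Fin n → ℕ)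
    (hf : IsMultiplicativeFn f) (hp : ∀ i, (p i).Prime)
    (hdist : Function.Injective p)
    (hadm : AdmissibleParams a1 b1 a2 b2)
    (hclass : InUniversalityClass f a1 b1 a2 b2)
    (K γ : ℝ) (hK : 0 < K) (hγ : γ < a1) (rstar : ℕ)
    (hL : ∀ i : Fin n, ∀ r : ℕ, rstar ≤ r →
      |charL f (p i) (m i) r| ≤ K * (p i : ℝ) ^ (γ * r)) :
    ∃ R : Fin n → ℝ, ∃ Rtot : ℝ,
      (∀ i : Fin n,
        Tendsto (fun N : ℕ =>
            (∑ k ∈ Finset.Icc 1 N, f (p i ^ m i * k)) /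
              (∑ k ∈ Finset.Icc 1 N, f k))
          atTop (nhds (R i))) ∧
      Tendsto (fun N : ℕ =>
          (∑ k ∈ Finset.Icc 1 N, f (k * ∏ i, p i ^ m i)) /
            (∑ k ∈ Finset.Icc 1 N, f k))
        atTop (nhds Rtot) ∧
      Rtot = ∏ i, R i := by
  obtain ⟨Fc, C, hFc, hC, hlim, -⟩ := hclass
  have hone : ∀ᶠ N : ℕ in atTop, 0 < hcmp a1 b1 N := by
    filter_upwards [eventually_ge_atTop 2] with N hN
    exact hcmp_pos _ _ _ (by exact_mod_cast (by omega : 1 < N))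
  have hbase : Tendsto (fun N : ℕ => (∑ k ∈ Finset.Icc 1 N, f k) / hcmp a1 b1 N) atTop
      (nhds Fc) := by
    have := hlim.const_mul Fc
    rw [mul_one] at this
    refine this.congr' ?_
    filter_upwards [hone] with N hN
    rw [mul_assoc Fc]
    change Fc * (_ / (Fc * hcmp a1 b1 N)) = _
    field_simp
  set ρ : Fin n → ℝ := fun i => ∑' r : ℕ, charL f (p i) (m i) r * ((p i ^ r : ℕ) : ℝ) ^ (-a1)
    with hρ
  have hind : ∀ s : Finset (Fin n), Tendsto (fun N : ℕ =>
      (∑ k ∈ Finset.Icc 1 N, f (k * ∏ i ∈ s, p i ^ m i)) / hcmp a1 b1 N) atTop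
      (nhds (Fc * ∏ i ∈ s, ρ i)) := by
    intro s
    induction s using Finset.induction_on with
    | empty => simpa using hbase
    | insert i s his ih =>
      have hP : 0 < ∏ j ∈ s, p j ^ m j :=
        Finset.prod_pos fun j _ => pow_pos (hp j).pos _
      have hcop : Nat.Coprime (p i) (∏ j ∈ s, p j ^ m j) := by
        apply Nat.Coprime.prod_right
        intro j hj
        apply Nat.Coprime.pow_right
        rw [Nat.coprime_primes (hp i) (hp j)]
        intro h
        exact his (hdist h ▸ hj)
      have := main_step (fun N => ∑ k ∈ Finset.Icc 1 N, f (k * ∏ j ∈ s, p j ^ m j))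
        (charL f (p i) (m i)) a1 b1 _ K γ (p i) rstar (hp i) hadm.1 hγ (hL i) (by simp) ih
      rw [Finset.prod_insert his, Finset.prod_insert his,
        show Fc * (ρ i * ∏ j ∈ s, ρ j) = Fc * (∏ j ∈ s, ρ j) * ρ i by ring]
      refine this.congr fun N => ?_
      rw [sum_conv f hf (p i) (m i) _ N (hp i) hP hcop]
  have hquot : ∀ s : Finset (Fin n), Tendsto (fun N : ℕ =>
      (∑ k ∈ Finset.Icc 1 N, f (k * ∏ i ∈ s, p i ^ m i)) / (∑ k ∈ Finset.Icc 1 N, f k)) atTop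
      (nhds (∏ i ∈ s, ρ i)) := by
    intro s
    have h := (hind s).div hbase hFc.ne'
    rw [mul_div_cancel_left₀ _ hFc.ne'] at h
    refine h.congr' ?_
    filter_upwards [hone] with N hN
    simp only [Pi.div_apply]
    rw [div_div_div_cancel_right₀ hN.ne']
  refine ⟨ρ, ∏ i, ρ i, fun i => ?_, hquot Finset.univ, rfl⟩
  have := hquot {i}
  simpa [mul_comm] using this
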